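/- Let S = {(0,k) : k ∈ ℕ} ∪ {(1,k) : k ≥ 1} ∪ {(k,0) : k ≥ 2} ⊆ ℕ × ℕ. There is no nonnegative matrix M : ℕ → ℕ → ℝ with Geom(1/5) marginals such that M(k,l) = 0 for every (k,l) ∉ S. -/

import Mathlib

/-- With `S = {(0,k) : k ∈ ℕ} ∪ {(1,k) : k ≥ 1} ∪ {(k,0) : k ≥ 2}`,
there is no nonnegative matrix `M : ℕ → ℕ → ℝ` with `Geom(1/5)` marginals
(`δ_{1/5}(k) = (1 - 1/5)^k * (1/5)`) vanishing outside `S`. -/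
theorem no_geom_fifth_matrix_supported_on_S :
    ¬ ∃ M : ℕ → ℕ → ℝ,
        (∀ k l, 0 ≤ M k l) ∧
        (∀ k, Summable fun l => M k l) ∧
        (∀ k, Summable fun l => M l k) ∧
        (∀ k, ∑' l, M k l = (1 - 1 / 5 : ℝ) ^ k * (1 / 5)) ∧
        (∀ k, ∑' l, M l k = (1 - 1 / 5 : ℝ) ^ k * (1 / 5)) ∧
        (∀ k l : ℕ, ¬ (k = 0 ∨ (k = 1 ∧ 1 ≤ l) ∨ (l = 0 ∧ 2 ≤ k)) → M k l = 0) := by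
  rintro ⟨M, hnonneg, -, hcol, hrow_sum, hcol_sum, hsupp⟩
  have hentry : ∀ k, 2 ≤ k → M k 0 = (1 - 1 / 5 : ℝ) ^ k * (1 / 5) := fun k hk => by
    rw [← hrow_sum k, tsum_eq_single 0 fun l hl => hsupp k l (by omega)]
  have hle := (hcol 0).sum_le_tsum {2, 3} fun l _ => hnonneg l 0
  rw [hcol_sum 0, Finset.sum_pair (by norm_num), hentry 2 le_rfl, hentry 3 (by norm_num)] at hle
  norm_num at hle
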